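/- (Perfect CCI suppression under the orthogonality condition.) Let 0 < L ≤ T, and for each round u = 1,…,k let H_l^{(u)} ∈ ℂ^{N_R × N_T} (l = 0,…,L−1) be channel tap matrices with frequency responses Λ_i^{(u)} := Σ_{l=0}^{L−1} H_l^{(u)} exp(−2πi·i·l/T), and let Λ̲_i := [Λ_i^{(1)⊤},…,Λ_i^{(k)⊤}]^⊤ ∈ ℂ^{k N_R × N_T} for i = 0,…,T−1. Let Π ∈ ℂ^{k N_R × ρ}, σ² > 0, and Ξ := Π Π^H + σ² I_{k N_R}. If Π^H Λ̲_i = 0 for every i, then Σ_{i=0}^{T−1} tr( Λ̲_i^H Ξ^{−1} Λ̲_i ) = (T/σ²) · Σ_{u=1}^{k} Σ_{l=0}^{L−1} tr( (H_l^{(u)})^H H_l^{(u)} ); that is, the post-combining signal-to-interference-plus-noise ratio equals the matched-filter SNR of the corresponding CCI-free MIMO-ISI ARQ channel, so the co-channel interference is completely removed. -/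

import Mathlib

open Matrix

lemma aux_orth (T : ℕ) (hT : T ≠ 0) (l m : ℕ) (hl : l < T) (hm : m < T) :
    ∑ i : Fin T, star (Complex.exp (-(2 * (Real.pi : ℂ) * Complex.I * ((i : ℕ) : ℂ) * (l : ℂ)) / (T : ℂ))) *
      Complex.exp (-(2 * (Real.pi : ℂ) * Complex.I * ((i : ℕ) : ℂ) * (m : ℂ)) / (T : ℂ)) =
      if l = m then (T : ℂ) else 0 := by
  have hζ := Complex.isPrimitiveRoot_exp T hT
  set ζ := Complex.exp (2 * Real.pi * Complex.I / T) with hζd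
  have hz0 : ζ ≠ 0 := Complex.exp_ne_zero _
  have key : ∀ i : Fin T, star (Complex.exp (-(2 * (Real.pi : ℂ) * Complex.I * ((i : ℕ) : ℂ) * (l : ℂ)) / (T : ℂ))) *
      Complex.exp (-(2 * (Real.pi : ℂ) * Complex.I * ((i : ℕ) : ℂ) * (m : ℂ)) / (T : ℂ)) =
      (ζ ^ l / ζ ^ m) ^ (i : ℕ) := by
    intro i
    rw [hζd, ← Complex.exp_nat_mul, ← Complex.exp_nat_mul, ← Complex.exp_sub, ← Complex.exp_nat_mul,
      Complex.star_def, ← Complex.exp_conj, ← Complex.exp_add]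
    congr 1
    simp only [map_div₀, map_neg, map_mul, Complex.conj_ofReal, Complex.conj_I, map_natCast, map_ofNat]
    ring
  rw [Finset.sum_congr rfl (fun i _ => key i), Fin.sum_univ_eq_sum_range (fun i => (ζ ^ l / ζ ^ m) ^ i)]
  split_ifs with h
  · subst h
    simp [div_self (pow_ne_zero l hz0)]
  · have hne : ζ ^ l / ζ ^ m ≠ 1 := by
      intro h1
      rw [div_eq_one_iff_eq (pow_ne_zero m hz0)] at h1
      exact h (hζ.pow_inj hl hm h1)
    rw [geom_sum_eq hne, div_pow, ← pow_mul, ← pow_mul, mul_comm l, mul_comm m, pow_mul, pow_mul,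
      hζ.pow_eq_one]
    simp

lemma aux_parseval (T L : ℕ) (hL : 0 < L) (hLT : L ≤ T) (a : ℕ → ℂ) :
    ∑ i : Fin T, star (∑ l ∈ Finset.range L, Complex.exp (-(2 * (Real.pi : ℂ) * Complex.I * ((i : ℕ) : ℂ) * (l : ℂ)) / (T : ℂ)) * a l) *
      (∑ l ∈ Finset.range L, Complex.exp (-(2 * (Real.pi : ℂ) * Complex.I * ((i : ℕ) : ℂ) * (l : ℂ)) / (T : ℂ)) * a l) =
      (T : ℂ) * ∑ l ∈ Finset.range L, star (a l) * a l := by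
  simp_rw [star_sum, Finset.sum_mul_sum]
  rw [Finset.sum_comm, Finset.mul_sum]
  refine Finset.sum_congr rfl fun l hl => ?_
  rw [Finset.sum_comm]
  have hl' := Finset.mem_range.1 hl
  have : ∀ m ∈ Finset.range L, ∑ i : Fin T,
      star (Complex.exp (-(2 * (Real.pi : ℂ) * Complex.I * ((i : ℕ) : ℂ) * (l : ℂ)) / (T : ℂ)) * a l) *
      (Complex.exp (-(2 * (Real.pi : ℂ) * Complex.I * ((i : ℕ) : ℂ) * (m : ℂ)) / (T : ℂ)) * a m) =
      if l = m then (T : ℂ) * (star (a l) * a m) else 0 := by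
    intro m hm
    have hm' := Finset.mem_range.1 hm
    have := aux_orth T (by omega) l m (by omega) (by omega)
    rw [← zero_mul (star (a l) * a m), ← ite_mul, ← this, Finset.sum_mul]
    refine Finset.sum_congr rfl fun i _ => ?_
    rw [star_mul]
    ring
  rw [Finset.sum_congr rfl this, Finset.sum_ite_eq, if_pos hl]

open scoped ComplexOrder in
lemma aux_inv {n p q : Type*} [Fintype n] [DecidableEq n] [Fintype p] [Fintype q]
    (P : Matrix n p ℂ) (A : Matrix n q ℂ) (s : ℝ) (hs : 0 < s) (h : Pᴴ * A = 0) :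
    (P * Pᴴ + (s : ℂ) • (1 : Matrix n n ℂ))⁻¹ * A = (s : ℂ)⁻¹ • A := by
  have hs0 : (s : ℂ) ≠ 0 := by exact_mod_cast hs.ne'
  have hpd : (P * Pᴴ + (s : ℂ) • (1 : Matrix n n ℂ)).PosDef := by
    refine Matrix.PosDef.posSemidef_add (Matrix.posSemidef_self_mul_conjTranspose P) ?_
    exact Matrix.PosDef.one.smul (by exact_mod_cast hs)
  have hu := (Matrix.isUnit_iff_isUnit_det _).1 hpd.isUnit
  have h2 : (P * Pᴴ + (s : ℂ) • (1 : Matrix n n ℂ)) * ((s : ℂ)⁻¹ • A) = A := by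
    rw [Matrix.mul_smul, Matrix.add_mul, Matrix.mul_assoc, h]
    rw [Matrix.mul_zero, zero_add, Matrix.smul_mul, Matrix.one_mul, smul_smul, inv_mul_cancel₀ hs0, one_smul]
  conv_lhs => rw [← h2]
  rw [Matrix.nonsing_inv_mul_cancel_left _ _ hu]

/-- Perfect CCI suppression under the orthogonality condition: with per-round
tap matrices `H_l^{(u)}`, frequency responses `Λ_i^{(u)} = ∑_l H_l^{(u)} exp(−2πi·i·l/T)`
stacked into `Λ̲_i ∈ ℂ^{kN_R×N_T}`, interference factor `Π ∈ ℂ^{kN_R×ρ}`, `σ² > 0`, and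
`Ξ := Π Πᴴ + σ² I`, if `Πᴴ Λ̲_i = 0` for every `i`, then
`∑_i tr(Λ̲_iᴴ Ξ⁻¹ Λ̲_i) = (T/σ²) ∑_u ∑_l tr((H_l^{(u)})ᴴ H_l^{(u)})`. -/
theorem stmt_13 (T L k NR NT ρ : ℕ) (hL : 0 < L) (hLT : L ≤ T)
    (H : Fin k → ℕ → Matrix (Fin NR) (Fin NT) ℂ)
    (Λ : Fin k → Fin T → Matrix (Fin NR) (Fin NT) ℂ)
    (hΛ : ∀ (u : Fin k) (i : Fin T), Λ u i = ∑ l ∈ Finset.range L,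
      Complex.exp (-(2 * (Real.pi : ℂ) * Complex.I * ((i : ℕ) : ℂ) * (l : ℂ)) / (T : ℂ)) • H u l)
    (Λs : Fin T → Matrix (Fin NR × Fin k) (Fin NT) ℂ)
    (hΛs : ∀ (i : Fin T) (r : Fin NR) (u : Fin k) (t : Fin NT), Λs i (r, u) t = Λ u i r t)
    (Pm : Matrix (Fin NR × Fin k) (Fin ρ) ℂ) (σ2 : ℝ) (hσ : 0 < σ2)
    (hperp : ∀ i : Fin T, Pmᴴ * Λs i = 0) :
    ∑ i : Fin T,
        ((Λs i)ᴴ *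
          (Pm * Pmᴴ + (σ2 : ℂ) • (1 : Matrix (Fin NR × Fin k) (Fin NR × Fin k) ℂ))⁻¹ *
            Λs i).trace =
      ((T : ℂ) / (σ2 : ℂ)) * ∑ u : Fin k, ∑ l ∈ Finset.range L, ((H u l)ᴴ * H u l).trace := by
  have h1 : ∀ i : Fin T, ((Λs i)ᴴ *
          (Pm * Pmᴴ + (σ2 : ℂ) • (1 : Matrix (Fin NR × Fin k) (Fin NR × Fin k) ℂ))⁻¹ *
            Λs i).trace = (σ2 : ℂ)⁻¹ * ∑ t : Fin NT, ∑ r : Fin NR, ∑ u : Fin k,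
              star (Λ u i r t) * Λ u i r t := by
    intro i
    rw [Matrix.mul_assoc, aux_inv Pm (Λs i) σ2 hσ (hperp i), Matrix.mul_smul, Matrix.trace_smul,
      smul_eq_mul]
    simp only [Matrix.trace, Matrix.diag_apply, Matrix.mul_apply, Matrix.conjTranspose_apply,
      Fintype.sum_prod_type, hΛs]
  have h2 : ∀ u r t, ∑ i : Fin T, star (Λ u i r t) * Λ u i r t =
      (T : ℂ) * ∑ l ∈ Finset.range L, star (H u l r t) * H u l r t := by
    intro u r t
    rw [← aux_parseval T L hL hLT (fun l => H u l r t)]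
    refine Finset.sum_congr rfl fun i _ => ?_
    simp only [hΛ, Matrix.sum_apply, Matrix.smul_apply, smul_eq_mul]
  have h3 : ∑ i : Fin T, ∑ t : Fin NT, ∑ r : Fin NR, ∑ u : Fin k,
      star (Λ u i r t) * Λ u i r t =
      ∑ t : Fin NT, ∑ r : Fin NR, ∑ u : Fin k,
        (T : ℂ) * ∑ l ∈ Finset.range L, star (H u l r t) * H u l r t := by
    rw [Finset.sum_comm]
    refine Finset.sum_congr rfl fun t _ => ?_
    rw [Finset.sum_comm]
    refine Finset.sum_congr rfl fun r _ => ?_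
    rw [Finset.sum_comm]
    exact Finset.sum_congr rfl fun u _ => h2 u r t
  have h4 : ∑ u : Fin k, ∑ l ∈ Finset.range L, ((H u l)ᴴ * H u l).trace =
      ∑ t : Fin NT, ∑ r : Fin NR, ∑ u : Fin k,
        ∑ l ∈ Finset.range L, star (H u l r t) * H u l r t := by
    simp only [Matrix.trace, Matrix.diag_apply, Matrix.mul_apply, Matrix.conjTranspose_apply]
    simp_rw [Finset.sum_comm (s := Finset.range L)]
    rw [Finset.sum_comm]
    refine Finset.sum_congr rfl fun t _ => ?_
    rw [Finset.sum_comm]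
  rw [Finset.sum_congr rfl (fun i _ => h1 i), ← Finset.mul_sum, h3, h4]
  simp_rw [← Finset.mul_sum]
  ring
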